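/- Let u : Y → C be a surjective morphism of complex projective varieties, where C is a smooth projective curve over ℂ. Then there exists a multisection of u: a smooth projective curve X over ℂ together with a finite surjective morphism f : X → C and a morphism s : X → Y such that u ∘ s = f. -/

import Mathlib

section MsAlgebra

open TensorProduct

theorem ms_formallyEtale {P L : Type} [CommRing P] [IsDomain P] [Field L] [CharZero L] [Algebra P L]
    (hinj : Function.Injective (algebraMap P L)) [Algebra.IsAlgebraic P L] :
    Algebra.FormallyEtale P L := by
  have : FaithfulSMul P L := (faithfulSMul_iff_algebraMap_injective P L).mpr hinj
  let K := FractionRing P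
  let _ : Algebra K L := FractionRing.liftAlgebra P L
  have : IsScalarTower P K L := FractionRing.isScalarTower_liftAlgebra P L
  have : CharZero K := (algebraMap K L).charZero_iff (algebraMap K L).injective |>.mpr inferInstance
  have : Algebra.IsAlgebraic K L := Algebra.IsAlgebraic.extendScalars (IsFractionRing.injective P K)
  have : Algebra.FormallyEtale P K := .of_isLocalization (nonZeroDivisors P)
  have : Algebra.FormallyEtale K L := .of_isSeparable K L
  exact .comp P K L

theorem ms_rank {k P L : Type} [Field k] [CommRing P] [IsDomain P] [Field L] [CharZero L] [Algebra P L]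
    [Algebra k P] [Algebra k L] [IsScalarTower k P L] (hinj : Function.Injective (algebraMap P L))
    [Algebra.IsAlgebraic P L] [Module.Free P (Ω[P⁄k])] [Module.Finite P (Ω[P⁄k])] :
    Module.finrank L (Ω[L⁄k]) = Module.finrank P (Ω[P⁄k]) := by
  have := ms_formallyEtale hinj
  rw [← (KaehlerDifferential.tensorKaehlerEquivOfFormallyEtale k P L).finrank_eq, Module.finrank_baseChange]

theorem ms_noether {k R L : Type} (A : Type) [Field k] [CommRing A] [CommRing R] [Field L] [CharZero L] [Algebra k R] [Algebra R L]
    [Algebra A R] [Algebra A L] [IsScalarTower A R L]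
    (hAL : Function.Injective (algebraMap A L)) [Algebra.IsAlgebraic A L]
    [Algebra k L] [IsScalarTower k R L] [Algebra.FiniteType k R]
    (hrk : Module.finrank L (Ω[L⁄k]) = 1) :
    ∃ g : Polynomial k →ₐ[k] R, Function.Injective ((algebraMap R L).comp g.toRingHom) ∧
      ∀ r : R, ((algebraMap R L).comp g.toRingHom).IsIntegralElem (algebraMap R L r) := by
  let φ : R →ₐ[k] L := IsScalarTower.toAlgHom k R L
  let R' := φ.range
  have : Algebra.FiniteType k R' :=
    Algebra.FiniteType.of_surjective φ.rangeRestrict φ.rangeRestrict_surjective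
  obtain ⟨s, g0, hg0, hint⟩ := exists_integral_inj_algHom_of_fg k R'
  let h := R'.val.comp g0
  have hinj : Function.Injective h := Subtype.val_injective.comp hg0
  have hs : s = 1 := by
    algebraize [h.toRingHom, g0.toRingHom]
    have t1 : IsScalarTower (MvPolynomial (Fin s) k) R' L := .of_algebraMap_eq' rfl
    have t2 : IsScalarTower k (MvPolynomial (Fin s) k) L := .of_algebraMap_eq' h.comp_algebraMap.symm
    have i1 : Algebra.IsIntegral (MvPolynomial (Fin s) k) R' := ⟨hint⟩
    have a1 : Algebra.IsAlgebraic R' L := by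
      let ψ : A →+* R' := φ.rangeRestrict.toRingHom.comp (algebraMap A R)
      have hψ : (algebraMap R' L).comp ψ = algebraMap A L := by
        ext a; exact (IsScalarTower.algebraMap_apply A R L a).symm
      algebraize [ψ]
      have : IsScalarTower A R' L := .of_algebraMap_eq' hψ.symm
      refine Algebra.IsAlgebraic.extendScalars (R := A) ?_
      refine Function.Injective.of_comp (f := algebraMap R' L) ?_
      rw [← RingHom.coe_comp]
      exact hψ ▸ hAL
    have a2 : Algebra.IsAlgebraic (MvPolynomial (Fin s) k) L := Algebra.IsAlgebraic.trans _ R' _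
    have b := KaehlerDifferential.mvPolynomialBasis k (Fin s)
    have := Module.Free.of_basis b
    have := Module.Finite.of_basis b
    have := ms_rank (k := k) (P := MvPolynomial (Fin s) k) (L := L) hinj
    rw [hrk, Module.finrank_eq_card_basis b] at this
    simpa using this.symm
  subst hs
  obtain ⟨r0, hr0⟩ := φ.rangeRestrict_surjective (g0 (MvPolynomial.X 0))
  let g : Polynomial k →ₐ[k] R := Polynomial.aeval r0
  let e : Polynomial k ≃ₐ[k] MvPolynomial (Fin 1) k := (MvPolynomial.uniqueAlgEquiv k (Fin 1)).symm
  have key : φ.comp g = h.comp e.toAlgHom := by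
    apply Polynomial.algHom_ext
    have : φ r0 = h (MvPolynomial.X 0) := congr_arg Subtype.val hr0
    simpa [g, e] using this
  have key' : (algebraMap R L).comp g.toRingHom = h.toRingHom.comp e.toAlgHom.toRingHom :=
    congr_arg AlgHom.toRingHom key
  refine ⟨g, ?_⟩
  rw [key']
  refine ⟨hinj.comp e.injective, fun r => ?_⟩
  obtain ⟨p, hp, hr⟩ := hint (φ.rangeRestrict r)
  refine ⟨p.map e.symm.toAlgHom.toRingHom, hp.map _, ?_⟩
  rw [Polynomial.eval₂_map]
  have : (h.toRingHom.comp e.toAlgHom.toRingHom).comp e.symm.toAlgHom.toRingHom = R'.val.toRingHom.comp g0.toRingHom := by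
    ext x <;> simp [h]
  rw [this]
  have := congr_arg R'.val.toRingHom hr
  rw [Polynomial.hom_eval₂] at this
  simpa [φ] using this

theorem ms_concl1 {k R B L : Type} (A : Type) [Field k] [CommRing A] [CommRing R] [CommRing B] [Field L]
    [CharZero L] [Algebra k R] [Algebra R L] [Algebra A R] [Algebra A L] [IsScalarTower A R L]
    (hAL : Function.Injective (algebraMap A L)) [Algebra.IsAlgebraic A L]
    [Algebra k L] [IsScalarTower k R L] [Algebra.FiniteType k R] [Algebra.EssFiniteType k L]
    [Algebra R B] [Algebra B L] [IsScalarTower R B L] [IsIntegralClosure B R L]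
    (hrk : Module.finrank L (Ω[L⁄k]) = 1) :
    Module.Finite R B ∧ IsDedekindDomain B ∧ ¬ IsField B := by
  obtain ⟨g, hg, hgi⟩ := ms_noether (R := R) A hAL hrk
  have hBL : Function.Injective (algebraMap B L) := IsIntegralClosure.algebraMap_injective B R L
  have : IsDomain B := hBL.isDomain _
  let gB : Polynomial k →+* B := (algebraMap R B).comp g.toRingHom
  let gL : Polynomial k →+* L := (algebraMap R L).comp g.toRingHom
  algebraize [g.toRingHom, gB, gL]
  let P := Polynomial k
  have : IsScalarTower P R L := .of_algebraMap_eq' rfl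
  have : IsScalarTower P R B := .of_algebraMap_eq' rfl
  have : IsScalarTower P B L := .of_algebraMap_eq' (by
    change (algebraMap R L).comp g.toRingHom = (algebraMap B L).comp ((algebraMap R B).comp g.toRingHom)
    rw [← RingHom.comp_assoc, ← IsScalarTower.algebraMap_eq])
  have : IsScalarTower k P L := .of_algebraMap_eq' (by
    change algebraMap k L = ((algebraMap R L).comp g.toRingHom).comp (algebraMap k P)
    rw [RingHom.comp_assoc, IsScalarTower.algebraMap_eq k R L]
    congr 1
    exact g.comp_algebraMap.symm)
  have hPL : Function.Injective (algebraMap P L) := hg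
  have hPB : Function.Injective (algebraMap P B) := by
    refine Function.Injective.of_comp (f := algebraMap B L) ?_
    rw [← RingHom.coe_comp, ← IsScalarTower.algebraMap_eq]
    exact hPL
  have hiff : ∀ x : L, IsIntegral R x ↔ IsIntegral P x := by
    intro x
    refine ⟨fun hx => ?_, fun hx => hx.tower_top⟩
    let O := integralClosure P L
    let ψ : R →+* O := (algebraMap R L).codRestrict O.toSubring hgi
    have hψ : (algebraMap O L).comp ψ = algebraMap R L := rfl
    have h1 : IsIntegral O x := by
      obtain ⟨p, hp, hx⟩ := hx
      refine ⟨p.map ψ, hp.map _, ?_⟩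
      rw [Polynomial.eval₂_map, hψ]; exact hx
    exact isIntegral_trans x h1
  have : IsIntegralClosure B P L := ⟨hBL, by
    intro x
    rw [← hiff]
    exact IsIntegralClosure.isIntegral_iff⟩
  have : Algebra.IsIntegral P B := IsIntegralClosure.isIntegral_algebra P L
  have : Algebra.IsAlgebraic B L := by
    let ψ : A →+* B := (algebraMap R B).comp (algebraMap A R)
    have hψ : (algebraMap B L).comp ψ = algebraMap A L := by
      rw [← RingHom.comp_assoc, ← IsScalarTower.algebraMap_eq, ← IsScalarTower.algebraMap_eq]
    algebraize [ψ]
    have : IsScalarTower A B L := .of_algebraMap_eq' hψ.symm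
    refine Algebra.IsAlgebraic.extendScalars (R := A) ?_
    refine Function.Injective.of_comp (f := algebraMap B L) ?_
    rw [← RingHom.coe_comp]
    exact hψ ▸ hAL
  have : Algebra.IsAlgebraic P L := Algebra.IsAlgebraic.trans _ B _
  have : FaithfulSMul P L := (faithfulSMul_iff_algebraMap_injective P L).mpr hPL
  let K := FractionRing P
  let _ : Algebra K L := FractionRing.liftAlgebra P L
  have : IsScalarTower P K L := FractionRing.isScalarTower_liftAlgebra P L
  have : CharZero K := (algebraMap K L).charZero_iff (algebraMap K L).injective |>.mpr inferInstance
  have : Algebra.IsAlgebraic K L := Algebra.IsAlgebraic.extendScalars (IsFractionRing.injective P K)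
  have : Algebra.EssFiniteType P L := .of_comp k P L
  have : Algebra.EssFiniteType K L := .of_comp P K L
  have : Module.Finite K L := Algebra.finite_of_essFiniteType_of_isAlgebraic
  have : Module.Finite P B := IsIntegralClosure.finite P K L B
  refine ⟨Module.Finite.of_restrictScalars_finite P R B, IsIntegralClosure.isDedekindDomain P K L B, ?_⟩
  intro hf
  exact Polynomial.not_isField k (isField_of_isIntegral_of_isField hPB hf)

theorem ms_quasiFinite {A B L : Type} [CommRing A] [CommRing B] [IsDedekindDomain B] [Field L]
    [Algebra A B] [Algebra B L] [Algebra A L] [IsScalarTower A B L] [Algebra.FiniteType A B]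
    (hAL : Function.Injective (algebraMap A L)) (hBL : Function.Injective (algebraMap B L))
    [Algebra.IsAlgebraic A L] : Algebra.QuasiFinite A B := by
  have hAB : Function.Injective (algebraMap A B) := by
    refine Function.Injective.of_comp (f := algebraMap B L) ?_
    rw [← RingHom.coe_comp, ← IsScalarTower.algebraMap_eq]
    exact hAL
  rw [Algebra.QuasiFinite.iff_finite_primesOver]
  intro I hI
  by_cases h0 : I = ⊥
  · refine (Set.finite_singleton (⊥ : Ideal B)).subset ?_
    rintro J ⟨hJ, hJI⟩
    by_contra hne
    obtain ⟨x, hx, hx0⟩ := Submodule.exists_mem_ne_zero_of_ne_bot hne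
    have hxa : IsAlgebraic A x :=
      (isAlgebraic_algebraMap_iff hBL).mp (Algebra.IsAlgebraic.isAlgebraic (algebraMap B L x))
    exact Ideal.comap_ne_bot_of_algebraic_mem hx0 hx hxa (hJI.over.symm.trans h0)
  · have hmap : I.map (algebraMap A B) ≠ 0 := (Ideal.map_eq_bot_iff_of_injective hAB).not.mpr h0
    have := UniqueFactorizationMonoid.fintypeSubtypeDvd (I.map (algebraMap A B)) hmap
    have : Finite {J : Ideal B | J ∣ I.map (algebraMap A B)} := this.finite
    refine (Set.toFinite {J : Ideal B | J ∣ I.map (algebraMap A B)}).subset ?_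
    rintro J ⟨hJ, hJI⟩
    exact Ideal.dvd_iff_le.mpr (Ideal.map_le_iff_le_comap.mpr hJI.over.le)

theorem ms_polySmooth (k : Type) [Field k] :
    Algebra.IsStandardSmoothOfRelativeDimension 1 k (Polynomial k) := by
  have : Algebra.IsStandardSmoothOfRelativeDimension 1 k (MvPolynomial (Fin 1) k) := by
    have : Algebra.IsStandardSmooth k (MvPolynomial (Fin 1) k) := by
      rw [Algebra.IsStandardSmooth.iff_exists_basis_kaehlerDifferential]
      refine ⟨inferInstance, Fin 1, KaehlerDifferential.mvPolynomialBasis k (Fin 1), ?_⟩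
      rintro _ ⟨i, rfl⟩
      simp
    rw [Algebra.IsStandardSmoothOfRelativeDimension.iff_of_isStandardSmooth]
    rw [rank_eq_card_basis (KaehlerDifferential.mvPolynomialBasis k (Fin 1))]
    simp
  exact .of_algEquiv 1 (MvPolynomial.uniqueAlgEquiv k (Fin 1))

theorem ms_map_eq {B : Type} [CommRing B] [IsDedekindDomain B] (m : Ideal B) [m.IsPrime]
    (hm : m ≠ ⊥) (t : B) (ht : t ∈ m) (ht2 : t ∉ m ^ 2) :
    (Ideal.span {t}).map (algebraMap B (Localization.AtPrime m)) =
      IsLocalRing.maximalIdeal (Localization.AtPrime m) := by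
  have h1 : Ideal.span {t} ⊔ m ^ 2 = m := by
    have := Ideal.eq_prime_pow_of_succ_lt_of_le (P := m) hm (i := 1) (I := Ideal.span {t} ⊔ m ^ 2) ?_ ?_
    · simpa using this
    · refine lt_of_le_of_ne le_sup_right fun h => ht2 ?_
      have : t ∈ Ideal.span {t} ⊔ m ^ 2 := Ideal.mem_sup_left (Ideal.mem_span_singleton_self t)
      rwa [← h] at this
    · rw [pow_one]
      refine sup_le ((Ideal.span_singleton_le_iff_mem _).mpr ht) (Ideal.pow_le_self two_ne_zero)
  have h2 := congr_arg (Ideal.map (algebraMap B (Localization.AtPrime m))) h1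
  rw [Ideal.map_sup, Ideal.map_pow, Localization.AtPrime.map_eq_maximalIdeal] at h2
  apply le_antisymm
  · rw [← h2]; exact le_sup_left
  · refine Submodule.le_of_le_smul_of_le_jacobson_bot (I := IsLocalRing.maximalIdeal (Localization.AtPrime m)) ?_ ?_ ?_
    · exact IsNoetherian.noetherian _
    · exact IsLocalRing.maximalIdeal_le_jacobson _
    · rw [smul_eq_mul, ← pow_two]; exact h2.ge

theorem ms_smooth {k B : Type} [Field k] [IsAlgClosed k] [CharZero k] [CommRing B] [IsDedekindDomain B]
    [Algebra k B] [Algebra.FiniteType k B] (m : Ideal B) [m.IsMaximal] (hm : m ≠ ⊥) :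
    ∃ g ∉ m, Algebra.IsStandardSmoothOfRelativeDimension 1 k (Localization.Away g) := by
  obtain ⟨t, ht, ht2⟩ : ∃ t ∈ m, t ∉ m ^ 2 := by
    by_contra! h
    exact (Ideal.pow_right_strictAnti m hm (Ideal.IsMaximal.ne_top inferInstance) (show 1 < 2 by simp)).not_ge (by beta_reduce; rw [pow_one]; exact h)
  have ht0 : t ≠ 0 := fun h => ht2 (h ▸ zero_mem _)
  let φ : Polynomial k →ₐ[k] B := Polynomial.aeval t
  have hφ : Function.Injective φ := by
    rw [← transcendental_iff_injective]
    intro halg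
    have hi : IsIntegral k t := halg.isIntegral
    have hm' := IsAlgClosed.degree_eq_one_of_irreducible k (minpoly.irreducible hi)
    obtain ⟨c, hc⟩ := (minpoly.degree_eq_one_iff).mp hm'
    have : c ≠ 0 := by rintro rfl; exact ht0 (by simpa using hc.symm)
    exact Ideal.IsMaximal.ne_top (I := m) inferInstance
      (Ideal.eq_top_of_isUnit_mem m ht (hc ▸ (this.isUnit.map (algebraMap k B))))
  algebraize [φ.toRingHom]
  let P := Polynomial k
  have : IsScalarTower k P B := .of_algebraMap_eq' φ.comp_algebraMap.symm
  have : FaithfulSMul P B := (faithfulSMul_iff_algebraMap_injective P B).mpr hφ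
  have : Module.Flat P B := inferInstance
  have : Algebra.FiniteType P B := .of_restrictScalars_finiteType k P B
  have : Algebra.FinitePresentation P B := Algebra.FinitePresentation.of_finiteType.mp inferInstance
  have hun : Algebra.IsUnramifiedAt P m := by
    let := Localization.AtPrime.algebraOfLiesOver (m.under P) m
    rw [Algebra.isUnramifiedAt_iff_map_eq (p := m.under P)]
    constructor
    · have : Module.Finite k (B ⧸ m) := by
        let : Field (B ⧸ m) := Ideal.Quotient.field m
        exact finite_of_finite_type_of_isJacobsonRing k (B ⧸ m)
      have : Module.Finite k m.ResidueField :=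
        Module.Finite.of_surjective (IsScalarTower.toAlgHom k (B ⧸ m) m.ResidueField).toLinearMap
          m.bijective_algebraMap_quotient_residueField.2
      have : Algebra.IsAlgebraic k m.ResidueField := inferInstance
      have : IsScalarTower k (m.under P).ResidueField m.ResidueField := inferInstance
      have : Algebra.IsAlgebraic (m.under P).ResidueField m.ResidueField := .tower_top (K := k) _
      have : CharZero (m.under P).ResidueField := charZero_of_injective_algebraMap (algebraMap k _).injective
      infer_instance
    · apply le_antisymm
      · have hc : Ideal.comap (algebraMap B (Localization.AtPrime m))
            (IsLocalRing.maximalIdeal (Localization.AtPrime m)) = m :=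
          Localization.AtPrime.under_maximalIdeal
        rw [Ideal.map_le_iff_le_comap, IsScalarTower.algebraMap_eq P B, ← Ideal.comap_comap, hc]
      · rw [← ms_map_eq m hm t ht ht2, Ideal.map_span, Set.image_singleton,
          Ideal.span_singleton_le_iff_mem]
        have hX : (Polynomial.X : P) ∈ m.under P := by
          change φ Polynomial.X ∈ m
          simpa [φ] using ht
        have := Ideal.mem_map_of_mem (algebraMap P (Localization.AtPrime m)) hX
        rw [IsScalarTower.algebraMap_apply P B] at this
        convert this
        change t = φ Polynomial.X
        simp [φ]
  have := Algebra.IsEtaleAt.of_isUnramifiedAt_of_flat (R := P) m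
  obtain ⟨g, hg, het⟩ := Algebra.exists_etale_of_isEtaleAt (R := P) m
  refine ⟨g, hg, ?_⟩
  have := Algebra.Etale.iff_isStandardSmoothOfRelativeDimension_zero.mp het
  have := ms_polySmooth k
  have : IsScalarTower k P (Localization.Away g) := inferInstance
  exact Algebra.IsStandardSmoothOfRelativeDimension.trans (n := 1) (m := 0) k P (Localization.Away g)

theorem ms_alg {A R B L : Type} [CommRing A] [CommRing R] [CommRing B] [Field L]
    (kA : ℂ →+* A) (a : A →+* R) (b : R →+* B) (l : B →+* L) (kL : ℂ →+* L)
    (hkL : l.comp (b.comp (a.comp kA)) = kL)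
    (hAL : Function.Injective (l.comp (b.comp a)))
    (halg : letI := (l.comp (b.comp a)).toAlgebra; Algebra.IsAlgebraic A L)
    (hft : (a.comp kA).FiniteType)
    (hess : letI := kL.toAlgebra; Algebra.EssFiniteType ℂ L)
    (hrk : letI := kL.toAlgebra; Module.finrank L (Ω[L⁄ℂ]) = 1)
    (hl : Function.Injective l)
    (hint : ∀ x : L, (l.comp b).IsIntegralElem x ↔ ∃ y, l y = x) :
    b.Finite ∧ (b.comp a).QuasiFinite ∧
      RingHom.Locally (RingHom.IsStandardSmoothOfRelativeDimension 1) (b.comp (a.comp kA)) := by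
  subst hkL
  let kR : ℂ →+* R := a.comp kA
  let kB : ℂ →+* B := b.comp (a.comp kA)
  let kL : ℂ →+* L := l.comp (b.comp (a.comp kA))
  let bL : R →+* L := l.comp b
  let aB : A →+* B := b.comp a
  let aL : A →+* L := l.comp (b.comp a)
  algebraize [kA, a, b, l, kR, kB, kL, bL, aB, aL]
  have : CharZero L := charZero_of_injective_algebraMap kL.injective
  have : Algebra.IsAlgebraic A L := halg
  have : Algebra.FiniteType ℂ R := hft
  have : Algebra.EssFiniteType ℂ L := hess
  have : IsScalarTower A R L := .of_algebraMap_eq' rfl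
  have : IsScalarTower A R B := .of_algebraMap_eq' rfl
  have : IsScalarTower A B L := .of_algebraMap_eq' rfl
  have : IsScalarTower R B L := .of_algebraMap_eq' rfl
  have : IsScalarTower ℂ R L := .of_algebraMap_eq' rfl
  have : IsScalarTower ℂ R B := .of_algebraMap_eq' rfl
  have : IsScalarTower ℂ A R := .of_algebraMap_eq' rfl
  have : IsIntegralClosure B R L := ⟨hl, fun {x} => hint x⟩
  obtain ⟨h1, h2, h3⟩ := ms_concl1 (k := ℂ) (R := R) (B := B) (L := L) A hAL hrk
  have : Algebra.FiniteType A R := .of_restrictScalars_finiteType ℂ A R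
  have : Algebra.FiniteType R B := inferInstance
  have : Algebra.FiniteType A B := .trans (S := R) inferInstance inferInstance
  have : Algebra.FiniteType ℂ B := .trans (S := R) inferInstance inferInstance
  refine ⟨h1, ms_quasiFinite (L := L) hAL hl, ?_⟩
  refine ⟨{g | Algebra.IsStandardSmoothOfRelativeDimension 1 ℂ (Localization.Away g)}, ?_, ?_⟩
  · by_contra hne
    obtain ⟨m, hm, hle⟩ := Ideal.exists_le_maximal _ hne
    have hm0 : m ≠ ⊥ := Ring.ne_bot_of_isMaximal_of_not_isField hm h3
    obtain ⟨g, hg, hs⟩ := ms_smooth (k := ℂ) m hm0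
    exact hg (hle (Ideal.subset_span hs))
  · intro g hg
    have : (algebraMap B (Localization.Away g)).comp (b.comp (a.comp kA)) = algebraMap ℂ (Localization.Away g) :=
      (IsScalarTower.algebraMap_eq ℂ B (Localization.Away g)).symm
    rw [this, RingHom.IsStandardSmoothOfRelativeDimension, toAlgebra_algebraMap]
    exact hg

theorem ms_fieldalg {A K L : Type} [CommRing A] [IsDomain A] [Field K] [Field L] [Algebra A K]
    [IsFractionRing A K] (ι : K →+* L) (hι : ι.Finite) (aL : A →+* L)
    (h : aL = ι.comp (algebraMap A K)) :
    Function.Injective aL ∧ (letI := aL.toAlgebra; Algebra.IsAlgebraic A L) ∧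
    ∀ (kA : ℂ →+* A) (kL : ℂ →+* L), kL = aL.comp kA → kA.IsStandardSmoothOfRelativeDimension 1 →
      (letI := kL.toAlgebra; Algebra.EssFiniteType ℂ L) ∧
      (letI := kL.toAlgebra; Module.finrank L (Ω[L⁄ℂ]) = 1) := by
  subst h
  let aL := ι.comp (algebraMap A K)
  let _ : Algebra K L := ι.toAlgebra
  let _ : Algebra A L := aL.toAlgebra
  have : IsScalarTower A K L := .of_algebraMap_eq' rfl
  have : Module.Finite K L := hι
  have hinj : Function.Injective aL := ι.injective.comp (IsFractionRing.injective A K)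
  have halg : Algebra.IsAlgebraic A L := by
    have : Algebra.IsAlgebraic A K := IsLocalization.isAlgebraic K (nonZeroDivisors A)
    have : Algebra.IsAlgebraic K L := inferInstance
    exact .trans A K L
  refine ⟨hinj, halg, ?_⟩
  rintro kA _ rfl hs
  let kL : ℂ →+* L := aL.comp kA
  let _ : Algebra ℂ A := kA.toAlgebra
  let _ : Algebra ℂ L := kL.toAlgebra
  have : IsScalarTower ℂ A L := .of_algebraMap_eq' rfl
  have : CharZero L := charZero_of_injective_algebraMap kL.injective
  have hs' : Algebra.IsStandardSmoothOfRelativeDimension 1 ℂ A := hs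
  have : Algebra.IsStandardSmooth ℂ A := hs'.isStandardSmooth
  constructor
  · have : Algebra.EssFiniteType A K := .of_isLocalization K (nonZeroDivisors A)
    have : Algebra.EssFiniteType A L := .comp A K L
    exact .comp ℂ A L
  · have := ms_rank (k := ℂ) (P := A) (L := L) hinj
    refine this.trans ?_
    rw [Module.finrank, Algebra.IsStandardSmoothOfRelativeDimension.rank_kaehlerDifferential 1]
    simp

end MsAlgebra

open AlgebraicGeometry CategoryTheory

theorem ms_point (Y C : Scheme.{0}) [IsIntegral C] (u : Y ⟶ C) [LocallyOfFiniteType u] [Surjective u] :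
    ∃ (L : Type) (_ : Field L) (ι : C.functionField →+* L) (q : Spec (CommRingCat.of L) ⟶ Y), ι.Finite ∧
      q ≫ u = Spec.map (CommRingCat.ofHom ι) ≫ C.fromSpecStalk (genericPoint C) := by
  let j : Spec C.functionField ⟶ C := C.fromSpecStalk (genericPoint C)
  let P := Limits.pullback u j
  let π : P ⟶ Spec C.functionField := Limits.pullback.snd u j
  have hsurj : Surjective π := inferInstance
  obtain ⟨x, -⟩ := hsurj.surj (IsLocalRing.closedPoint C.functionField)
  obtain ⟨W, hW, hxW, -⟩ := exists_isAffineOpen_mem_and_subset (x := x) (U := ⊤) trivial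
  have : Nonempty W := ⟨⟨x, hxW⟩⟩
  have : Nontrivial Γ(P, W) := inferInstance
  obtain ⟨m, hm⟩ := Ideal.exists_maximal Γ(P, W)
  let φ : C.functionField ⟶ Γ(P, W) := Spec.preimage (hW.fromSpec ≫ π)
  have hφ : Spec.map φ = hW.fromSpec ≫ π := Spec.map_preimage _
  have hft : φ.hom.FiniteType := by
    have : LocallyOfFiniteType (Spec.map φ) := by rw [hφ]; infer_instance
    exact (HasRingHomProperty.Spec_iff (P := @LocallyOfFiniteType)).mp this
  let L := Γ(P, W) ⧸ m
  let _ : Field L := Ideal.Quotient.field m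
  let ι : C.functionField →+* L := (Ideal.Quotient.mk m).comp φ.hom
  refine ⟨L, inferInstance, ι,
    Spec.map (CommRingCat.ofHom (Ideal.Quotient.mk m)) ≫ hW.fromSpec ≫ Limits.pullback.fst u j, ?_, ?_⟩
  · have : ι.FiniteType := (RingHom.FiniteType.of_surjective _ Ideal.Quotient.mk_surjective).comp hft
    algebraize [ι]
    exact finite_of_finite_type_of_isJacobsonRing C.functionField L
  · have : CommRingCat.ofHom ι = φ ≫ CommRingCat.ofHom (Ideal.Quotient.mk m) := rfl
    rw [this, Spec.map_comp, hφ]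
    simp only [Category.assoc]
    rw [Limits.pullback.condition]

theorem ms_norm {X Y : Scheme.{0}} (f : X ⟶ Y) [QuasiCompact f] [QuasiSeparated f] {U : Y.Opens}
    (hU : IsAffineOpen U) {V : X.Opens} (hV : V = f ⁻¹ᵁ U)
    (e : V ≤ f.toNormalization ⁻¹ᵁ (f.fromNormalization ⁻¹ᵁ U)) :
    Function.Injective (f.toNormalization.appLE _ V e).hom ∧
    ∀ x : Γ(X, V), ((f.toNormalization.appLE _ V e).hom.comp (f.fromNormalization.app U).hom).IsIntegralElem x ↔
      ∃ y, (f.toNormalization.appLE _ V e).hom y = x := by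
  subst hV
  have hcomp : (f.toNormalization.appLE _ (f ⁻¹ᵁ U) e).hom.comp (f.fromNormalization.app U).hom = (f.app U).hom := by
    rw [← CommRingCat.hom_comp]
    congr 1
    rw [Scheme.Hom.app_eq_appLE, Scheme.Hom.appLE_comp_appLE, Scheme.Hom.app_eq_appLE]
    congr 1
    simp
  rw [hcomp]
  let := (f.app U).hom.toAlgebra
  have h := f.normalizationObjIso_hom_val hU
  have h' : ∀ y, (f.toNormalization.appLE _ (f ⁻¹ᵁ U) e).hom y = ((f.normalizationObjIso hU).hom.hom y).1 := by
    intro y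
    rw [← h]; rfl
  have hbij : Function.Bijective (f.normalizationObjIso hU).hom.hom :=
    ConcreteCategory.bijective_of_isIso (f.normalizationObjIso hU).hom
  constructor
  · intro y z hyz
    rw [h', h'] at hyz
    exact hbij.1 (Subtype.ext hyz)
  · intro x
    constructor
    · intro hx
      obtain ⟨y, hy⟩ := hbij.2 ⟨x, hx⟩
      exact ⟨y, by rw [h', hy]⟩
    · rintro ⟨y, rfl⟩
      rw [h']
      exact ((f.normalizationObjIso hU).hom.hom y).2

theorem ms_germ (X : Scheme.{0}) (x : X) {S : CommRingCat.{0}} (φ : X.presheaf.stalk x ⟶ S) (V : X.Opens)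
    (hx : x ∈ V) (e : ⊤ ≤ (Spec.map φ ≫ X.fromSpecStalk x) ⁻¹ᵁ V) :
    (Spec.map φ ≫ X.fromSpecStalk x).appLE V ⊤ e ≫ (Scheme.ΓSpecIso S).hom =
      X.presheaf.germ V x hx ≫ φ := by
  have e' : ⊤ ≤ Spec.map φ ⁻¹ᵁ (X.fromSpecStalk x ⁻¹ᵁ V) := e
  have h1 : (Spec.map φ ≫ X.fromSpecStalk x).appLE V ⊤ e =
      (X.fromSpecStalk x).app V ≫ (Spec.map φ).appLE _ ⊤ e' := Scheme.Hom.comp_appLE ..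
  have h2 : (Spec (X.presheaf.stalk x)).presheaf.map (homOfLE le_top).op ≫ (Spec.map φ).appLE _ ⊤ e' =
      (Spec.map φ).appTop := by
    rw [Scheme.Hom.map_appLE]
    simp [Scheme.Hom.appTop, Scheme.Hom.app_eq_appLE]
  rw [h1, Scheme.fromSpecStalk_app hx]
  simp only [Category.assoc]
  rw [reassoc_of% h2, Scheme.ΓSpecIso_naturality, Iso.inv_hom_id_assoc]

theorem ms_field (C : Scheme.{0}) (pC : C ⟶ Spec (CommRingCat.of ℂ)) [IsIntegral C]
    [SmoothOfRelativeDimension 1 pC] {L : Type} [Field L] (ι : C.functionField →+* L) (hι : ι.Finite)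
    (j : Spec (CommRingCat.of L) ⟶ C)
    (hj : j = Spec.map (CommRingCat.ofHom ι) ≫ C.fromSpecStalk (genericPoint C)) (kL : ℂ →+* L)
    (hkL : kL = ((Scheme.ΓSpecIso (CommRingCat.of ℂ)).inv ≫ (j ≫ pC).appLE ⊤ ⊤ le_top ≫
      (Scheme.ΓSpecIso (CommRingCat.of L)).hom).hom) :
    (letI := kL.toAlgebra; Algebra.EssFiniteType ℂ L) ∧
    (letI := kL.toAlgebra; Module.finrank L (Ω[L⁄ℂ]) = 1) ∧
    ∀ (V : C.Opens) (_ : IsAffineOpen V) (_ : Nonempty V) (e : ⊤ ≤ j ⁻¹ᵁ V),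
      Function.Injective (j.appLE V ⊤ e ≫ (Scheme.ΓSpecIso (CommRingCat.of L)).hom).hom ∧
      (letI := (j.appLE V ⊤ e ≫ (Scheme.ΓSpecIso (CommRingCat.of L)).hom).hom.toAlgebra;
        Algebra.IsAlgebraic Γ(C, V) L) := by
  have key : ∀ (V : C.Opens) (_ : Nonempty V) (e : ⊤ ≤ j ⁻¹ᵁ V),
      (j.appLE V ⊤ e ≫ (Scheme.ΓSpecIso (CommRingCat.of L)).hom).hom =
        ι.comp (algebraMap Γ(C, V) C.functionField) := by
    intro V hV e
    have hη : genericPoint C ∈ V :=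
      ((genericPoint_spec C).mem_open_set_iff V.isOpen).mpr (by simpa using hV)
    subst hj
    change _ = (C.presheaf.germ V (genericPoint C) hη ≫ CommRingCat.ofHom ι).hom
    congr 1
    exact ms_germ C (genericPoint C) (CommRingCat.ofHom ι) V hη e
  have hVη : ∀ V : C.Opens, Nonempty V → ⊤ ≤ j ⁻¹ᵁ V := by
    intro V hV x _
    have hη : genericPoint C ∈ V :=
      ((genericPoint_spec C).mem_open_set_iff V.isOpen).mpr (by simpa using hV)
    change j x ∈ V
    have hx : Spec.map (CommRingCat.ofHom ι) x = IsLocalRing.closedPoint C.functionField :=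
      Subsingleton.elim (α := PrimeSpectrum C.functionField) _ _
    rw [hj, Scheme.Hom.comp_apply, hx, Scheme.fromSpecStalk_closedPoint]
    exact hη
  obtain ⟨U, hU, V, hV, hη, e, hs⟩ :=
    SmoothOfRelativeDimension.exists_isStandardSmoothOfRelativeDimension (n := 1) (f := pC) (genericPoint C)
  have hUtop : U = ⊤ := by
    refine top_le_iff.mp fun x _ => ?_
    have hx : x = pC (genericPoint C) := Subsingleton.elim (α := PrimeSpectrum ℂ) _ _
    rw [hx]
    exact e hη
  subst hUtop
  have hVne : Nonempty V := ⟨⟨_, hη⟩⟩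
  let kA : CommRingCat.of ℂ ⟶ Γ(C, V) := (Scheme.ΓSpecIso (CommRingCat.of ℂ)).inv ≫ pC.appLE ⊤ V e
  have hkA : kA.hom.IsStandardSmoothOfRelativeDimension 1 :=
    RingHom.IsStandardSmoothOfRelativeDimension.comp (n := 1) (m := 0) hs
      (.equiv (Scheme.ΓSpecIso (CommRingCat.of ℂ)).symm.commRingCatIsoToRingEquiv)
  have := functionField_isFractionRing_of_isAffineOpen C V hV
  obtain ⟨-, -, h3⟩ := ms_fieldalg (A := Γ(C, V)) (K := C.functionField) ι hι _ (key V hVne (hVη V hVne))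
  obtain ⟨h4, h5⟩ := h3 kA.hom kL (by
    rw [hkL, ← CommRingCat.hom_comp]
    congr 1
    simp only [kA, Category.assoc]
    rw [Scheme.Hom.appLE_comp_appLE_assoc]) hkA
  refine ⟨h4, h5, fun V' hV' hne e' => ?_⟩
  have := functionField_isFractionRing_of_isAffineOpen C V' hV'
  obtain ⟨h1, h2, -⟩ := ms_fieldalg (A := Γ(C, V')) (K := C.functionField) ι hι _ (key V' hne e')
  exact ⟨h1, h2⟩

theorem ms_local (Y C : Scheme.{0})
    (pY : Y ⟶ Spec (CommRingCat.of ℂ)) (pC : C ⟶ Spec (CommRingCat.of ℂ)) [IsIntegral Y] [IsIntegral C]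
    [LocallyOfFiniteType pY] [SmoothOfRelativeDimension 1 pC] (u : Y ⟶ C) (hu : u ≫ pC = pY)
    {L : Type} [Field L] (ι : C.functionField →+* L) (hι : ι.Finite) (q : Spec (CommRingCat.of L) ⟶ Y)
    (hq : q ≫ u = Spec.map (CommRingCat.ofHom ι) ≫ C.fromSpecStalk (genericPoint C))
    [QuasiCompact q] [QuasiSeparated q] (x : q.normalization) :
    ∃ (V' : C.affineOpens) (U' : Y.affineOpens) (W : q.normalization.affineOpens) (_ : x ∈ W.1)
      (e1 : W.1 ≤ q.fromNormalization ⁻¹ᵁ U'.1) (e2 : W.1 ≤ (q.fromNormalization ≫ u) ⁻¹ᵁ V'.1)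
      (e3 : W.1 ≤ ((q.fromNormalization ≫ u) ≫ pC) ⁻¹ᵁ ⊤),
      (q.fromNormalization.appLE U'.1 W.1 e1).hom.FiniteType ∧
      ((q.fromNormalization ≫ u).appLE V'.1 W.1 e2).hom.QuasiFinite ∧
      RingHom.Locally (RingHom.IsStandardSmoothOfRelativeDimension 1)
        (((q.fromNormalization ≫ u) ≫ pC).appLE ⊤ W.1 e3).hom := by
  set s := q.fromNormalization with hs
  obtain ⟨V', hV', hxV, -⟩ := exists_isAffineOpen_mem_and_subset (X := C) (x := u (s x)) (U := ⊤) trivial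
  obtain ⟨U', hU', hxU, hUV⟩ := exists_isAffineOpen_mem_and_subset (X := Y) (x := s x) (U := u ⁻¹ᵁ V') hxV
  replace hUV : U' ≤ u ⁻¹ᵁ V' := hUV
  have hWV : s ⁻¹ᵁ U' ≤ (s ≫ u) ⁻¹ᵁ V' := s.preimage_mono hUV
  have eC : V' ≤ pC ⁻¹ᵁ ⊤ := fun _ _ => trivial
  have eY : U' ≤ pY ⁻¹ᵁ ⊤ := fun _ _ => trivial
  have eY' : U' ≤ (u ≫ pC) ⁻¹ᵁ ⊤ := fun _ _ => trivial
  have eX : s ⁻¹ᵁ U' ≤ ((s ≫ u) ≫ pC) ⁻¹ᵁ ⊤ := fun _ _ => trivial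
  have eL : ⊤ ≤ ((q ≫ u) ≫ pC) ⁻¹ᵁ ⊤ := fun _ _ => trivial
  have hW : IsAffineOpen (s ⁻¹ᵁ U') := hU'.preimage s
  have hd : DenseRange q.toNormalization := q.toNormalization.denseRange
  obtain ⟨_, hz, z, rfl⟩ := hd.exists_mem_open (s ⁻¹ᵁ U').isOpen ⟨x, hxU⟩ |>.elim fun z hz => (⟨_, hz, z, rfl⟩ : ∃ y ∈ (s ⁻¹ᵁ U'), ∃ z, q.toNormalization z = y)
  have eT : ⊤ ≤ q.toNormalization ⁻¹ᵁ (s ⁻¹ᵁ U') := by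
    intro z' _
    have : z' = z := Subsingleton.elim (α := PrimeSpectrum L) _ _
    rw [this]; exact hz
  have eQ : ⊤ ≤ q ⁻¹ᵁ U' := by
    have := q.toNormalization_fromNormalization
    rw [← this]
    exact eT
  have eJ : ⊤ ≤ (q ≫ u) ⁻¹ᵁ V' := eQ.trans (q.preimage_mono hUV)
  obtain ⟨hn1, hn2⟩ := ms_norm q hU' (V := ⊤) (top_le_iff.mp eQ).symm eT
  let gL := Scheme.ΓSpecIso (CommRingCat.of L)
  let gC := Scheme.ΓSpecIso (CommRingCat.of ℂ)
  let kA : CommRingCat.of ℂ ⟶ Γ(C, V') := gC.inv ≫ pC.appLE ⊤ V' eC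
  let a : Γ(C, V') ⟶ Γ(Y, U') := u.appLE V' U' hUV
  let b : Γ(Y, U') ⟶ Γ(q.normalization, s ⁻¹ᵁ U') := s.app U'
  let l : Γ(q.normalization, s ⁻¹ᵁ U') ⟶ CommRingCat.of L := q.toNormalization.appLE _ ⊤ eT ≫ gL.hom
  let kL : CommRingCat.of ℂ ⟶ CommRingCat.of L := gC.inv ≫ ((q ≫ u) ≫ pC).appLE ⊤ ⊤ eL ≫ gL.hom
  have hba : a ≫ b = (s ≫ u).appLE V' (s ⁻¹ᵁ U') hWV := by
    simp only [a, b, Scheme.Hom.app_eq_appLE]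
    rw [Scheme.Hom.appLE_comp_appLE]
  have habl : a ≫ b ≫ l = (q ≫ u).appLE V' ⊤ eJ ≫ gL.hom := by
    rw [reassoc_of% hba]
    simp only [l]
    rw [Scheme.Hom.appLE_comp_appLE_assoc]
    congr 2
    rw [hs, Scheme.Hom.toNormalization_fromNormalization_assoc]
  obtain ⟨hf1, hf2, hf3⟩ := ms_field C pC ι hι (q ≫ u) hq kL.hom rfl
  obtain ⟨hf4, hf5⟩ := hf3 V' hV' ⟨⟨_, hxV⟩⟩ eJ
  have habl' : (l.hom.comp (b.hom.comp a.hom)) = ((q ≫ u).appLE V' ⊤ eJ ≫ gL.hom).hom := by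
    rw [← habl]; rfl
  have hLb : ∀ y : L, ∃ y', gL.hom.hom y' = y := fun y => ⟨gL.inv.hom y, by simp⟩
  have hLi : Function.Injective gL.hom.hom := gL.commRingCatIsoToRingEquiv.injective
  obtain ⟨r1, r2, r3⟩ := ms_alg kA.hom a.hom b.hom l.hom kL.hom (by
      change (kA ≫ a ≫ b ≫ l).hom = kL.hom
      congr 1
      rw [habl]
      change (gC.inv ≫ pC.appLE ⊤ V' eC) ≫ (q ≫ u).appLE V' ⊤ eJ ≫ gL.hom =
        gC.inv ≫ ((q ≫ u) ≫ pC).appLE ⊤ ⊤ eL ≫ gL.hom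
      rw [Category.assoc gC.inv, Scheme.Hom.appLE_comp_appLE_assoc]) (by rw [habl']; exact hf4) (by
      rw [habl']; exact hf5) (by
      have : a.hom.comp kA.hom = (pY.appLE ⊤ U' eY).hom.comp gC.inv.hom := by
        change (kA ≫ a).hom = (gC.inv ≫ pY.appLE ⊤ U' eY).hom
        congr 1
        simp only [kA, a, Category.assoc]
        rw [Scheme.Hom.appLE_comp_appLE]
        subst hu
        rfl
      rw [this]
      refine RingHom.FiniteType.comp ?_ (RingHom.FiniteType.of_surjective _ gC.symm.commRingCatIsoToRingEquiv.surjective)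
      exact pY.finiteType_appLE (isAffineOpen_top _) hU' eY) hf1 hf2
      (hLi.comp hn1) (by
      intro y
      obtain ⟨y, rfl⟩ := hLb y
      have : (∃ w, l.hom w = gL.hom.hom y) ↔ ∃ w, (q.toNormalization.appLE _ ⊤ eT).hom w = y :=
        exists_congr fun w => hLi.eq_iff
      rw [this, ← hn2]
      constructor
      · rintro ⟨p, hp, h⟩
        refine ⟨p, hp, hLi ?_⟩
        rw [map_zero, Polynomial.hom_eval₂]
        exact h
      · rintro ⟨p, hp, h⟩
        refine ⟨p, hp, ?_⟩
        have := congrArg gL.hom.hom h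
        rw [map_zero, Polynomial.hom_eval₂] at this
        exact this)
  refine ⟨⟨V', hV'⟩, ⟨U', hU'⟩, ⟨_, hW⟩, hxU, le_rfl, hWV, eX, ?_, ?_, ?_⟩
  · rw [← Scheme.Hom.app_eq_appLE]
    exact r1.finiteType
  · rw [← hba]
    exact r2
  · have hr := (HasRingHomProperty.isLocal_ringHomProperty (@SmoothOfRelativeDimension 1)).respectsIso
    have : (((s ≫ u) ≫ pC).appLE ⊤ (s ⁻¹ᵁ U') eX).hom =
        (b.hom.comp (a.hom.comp kA.hom)).comp gC.commRingCatIsoToRingEquiv.toRingHom := by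
      change _ = (gC.hom ≫ ((gC.inv ≫ _) ≫ a) ≫ b).hom
      congr 1
      rw [Category.assoc _ a b, hba, Category.assoc gC.inv, Iso.hom_inv_id_assoc,
        Scheme.Hom.appLE_comp_appLE]
    rw [this]
    exact hr.2 _ _ r3

/-- **Existence of multisections** (Lemma 4.2 of the paper).
Let `u : Y ⟶ C` be a surjective morphism of complex projective varieties, where `C` is a
smooth projective curve over `ℂ`. Then there exists a multisection of `u`: a smooth
projective curve `X` over `ℂ` together with a finite surjective morphism `f : X ⟶ C`
(a branched cover) and a morphism `s : X ⟶ Y` with `u ∘ s = f`. -/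
theorem exists_multisection_over_curve
    (Y C : Scheme.{0})
    (pY : Y ⟶ Spec (CommRingCat.of ℂ)) (pC : C ⟶ Spec (CommRingCat.of ℂ))
    (hYint : IsIntegral Y) (hYproper : IsProper pY)
    (hCint : IsIntegral C) (hCproper : IsProper pC)
    (hCsmooth : IsSmoothOfRelativeDimension 1 pC)
    (u : Y ⟶ C) (hu : u ≫ pC = pY) (husurj : Function.Surjective u.base) :
    ∃ (X : Scheme.{0}) (pX : X ⟶ Spec (CommRingCat.of ℂ)) (f : X ⟶ C) (s : X ⟶ Y),
      IsIntegral X ∧ IsProper pX ∧ IsSmoothOfRelativeDimension 1 pX ∧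
      f ≫ pC = pX ∧ IsFinite f ∧ Function.Surjective f.base ∧ s ≫ u = f := by
  have hup : IsProper (u ≫ pC) := by rw [hu]; exact hYproper
  have hup' : IsProper u := IsProper.of_comp u pC
  have hus : Surjective u := ⟨husurj⟩
  obtain ⟨L, _, ι, q, hι, hq⟩ := ms_point Y C u
  have hqc : QuasiCompact q := by
    have : QuasiCompact (q ≫ pY) := inferInstance
    exact MorphismProperty.of_postcomp (W := @QuasiCompact) (W' := @QuasiSeparated) q pY inferInstance this
  have hqs : QuasiSeparated q := QuasiSeparated.of_comp q pY
  have hsm0 : SmoothOfRelativeDimension 1 pC := hCsmooth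
  have hloc := ms_local Y C pY pC u hu ι hι q hq
  have hft : LocallyOfFiniteType q.fromNormalization := by
    refine (HasRingHomProperty.iff_exists_appLE
      (RingHom.finiteType_stableUnderComposition.stableUnderCompositionWithLocalizationAway
        RingHom.finiteType_holdsForLocalizationAway).1).mpr fun x => ?_
    obtain ⟨V', U', W, hx, e1, e2, e3, r1, r2, r3⟩ := hloc x
    exact ⟨U', W, hx, e1, r1⟩
  have hsfin : IsFinite q.fromNormalization :=
    (IsFinite.iff_isIntegralHom_and_locallyOfFiniteType _).mpr ⟨inferInstance, hft⟩
  have hfp : IsProper (q.fromNormalization ≫ u) := inferInstance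
  have hlq : LocallyQuasiFinite (q.fromNormalization ≫ u) := by
    refine (HasRingHomProperty.iff_exists_appLE
      (RingHom.QuasiFinite.stableUnderComposition.stableUnderCompositionWithLocalizationAway
        RingHom.QuasiFinite.holdsForLocalizationAway).1).mpr fun x => ?_
    obtain ⟨V', U', W, hx, e1, e2, e3, r1, r2, r3⟩ := hloc x
    exact ⟨V', W, hx, e2, r2⟩
  have hsm : SmoothOfRelativeDimension 1 ((q.fromNormalization ≫ u) ≫ pC) := by
    refine (HasRingHomProperty.iff_exists_appLE
      (RingHom.locally_stableUnderCompositionWithLocalizationAwaySource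
        (RingHom.isStandardSmoothOfRelativeDimension_stableUnderCompositionWithLocalizationAway
          1).left)).mpr fun x => ?_
    obtain ⟨V', U', W, hx, e1, e2, e3, r1, r2, r3⟩ := hloc x
    exact ⟨⟨⊤, isAffineOpen_top _⟩, W, hx, e3, r3⟩
  refine ⟨q.normalization, (q.fromNormalization ≫ u) ≫ pC, q.fromNormalization ≫ u,
    q.fromNormalization, inferInstance, inferInstance, hsm, rfl,
    IsFinite.of_isProper_of_locallyQuasiFinite _, ?_, rfl⟩
  have hcl : IsClosed (Set.range (q.fromNormalization ≫ u)) :=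
    (q.fromNormalization ≫ u).isClosedMap.isClosed_range
  have hmem : genericPoint C ∈ Set.range (q.fromNormalization ≫ u) := by
    let z : Spec (CommRingCat.of L) := IsLocalRing.closedPoint L
    refine ⟨q.toNormalization z, ?_⟩
    rw [← Scheme.Hom.comp_apply, Scheme.Hom.toNormalization_fromNormalization_assoc, hq]
    have hx : Spec.map (CommRingCat.ofHom ι) z = IsLocalRing.closedPoint C.functionField :=
      Subsingleton.elim (α := PrimeSpectrum C.functionField) _ _
    rw [Scheme.Hom.comp_apply, hx, Scheme.fromSpecStalk_closedPoint]
  have hr : Set.range (q.fromNormalization ≫ u) = Set.univ := by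
    refine Set.univ_subset_iff.mp ?_
    rw [← (genericPoint_spec C : closure {genericPoint C} = Set.univ)]
    exact closure_minimal (Set.singleton_subset_iff.mpr hmem) hcl
  exact Set.range_eq_univ.mp hr
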